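/- Let k be a field, A ∈ k[t] squarefree of odd degree, f(x) = (x−α₀)(x−α₁)(x−α₂) ∈ k[x] with distinct roots, and F, G ∈ k[t] non-constant with A·G² = f(F). Set Fᵢ = F − αᵢ. Then F₀, F₁, F₂ are pairwise coprime, each deg Fᵢ is odd, and for each i there exist polynomials Nᵢ, Sᵢ ∈ k̄[t] with Nᵢ squarefree non-constant, Fᵢ = Nᵢ·Sᵢ², Nᵢ = gcd(A, Fᵢ), G = ±S₀S₁S₂ (up to a unit), and A = N₀N₁N₂ (up to a unit). -/

import Mathlib

open Polynomial

theorem aux17 {k : Type*} [Field k] [DecidableEq k] (A G H K : k[X]) (hH : H ≠ 0) (hA : A ≠ 0)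
    (hc : IsCoprime H K) (h : A * G ^ 2 = H * K) :
    ∃ N S : k[X], H = N * S ^ 2 ∧ Associated N (EuclideanDomain.gcd A H) := by
  obtain ⟨A', hA'⟩ := EuclideanDomain.gcd_dvd_left A H
  obtain ⟨H', hH'⟩ := EuclideanDomain.gcd_dvd_right A H
  have hb := EuclideanDomain.gcd_eq_gcd_ab A H
  have hD0 : EuclideanDomain.gcd A H ≠ 0 := fun h0 => hH (by rw [hH', h0, zero_mul])
  generalize EuclideanDomain.gcdA A H = x at hb
  generalize EuclideanDomain.gcdB A H = y at hb
  generalize EuclideanDomain.gcd A H = D at *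
  have hcop : IsCoprime A' H' := by
    refine ⟨x, y, mul_left_cancel₀ hD0 ?_⟩
    rw [hA', hH'] at hb
    linear_combination -hb
  have h2 : A' * G ^ 2 = H' * K := by
    apply mul_left_cancel₀ hD0
    rw [hA'] at h
    rw [← mul_assoc, ← mul_assoc, ← hH', h]
  obtain ⟨K', hK'⟩ : A' ∣ K := hcop.dvd_of_dvd_mul_left ⟨G ^ 2, h2.symm⟩
  have hc' : IsCoprime H' K := hc.of_isCoprime_of_dvd_left ⟨D, by rw [hH', mul_comm]⟩
  have hc'' : IsCoprime H' K' := hc'.of_isCoprime_of_dvd_right ⟨A', by rw [hK', mul_comm]⟩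
  have hH0 : H' ≠ 0 := fun h0 => hH (by rw [hH', h0, mul_zero])
  have h3 : H' * K' = G ^ 2 := by
    have hA0 : A' ≠ 0 := fun h0 => hA (by rw [hA', h0, mul_zero])
    apply mul_left_cancel₀ hA0
    rw [h2, hK']; ring
  obtain ⟨S, u, hu⟩ := exists_associated_pow_of_mul_eq_pow' hc'' h3
  refine ⟨D * u, S, ?_, ?_⟩
  · rw [hH', ← hu]; ring
  · exact (associated_mul_unit_left D u u.isUnit)

/-- Structure of a non-constant integral point `(F, G)` on `A(t)y² = f(x)` when `f`
splits: with `Fᵢ = F − αᵢ`, the `Fᵢ` are pairwise coprime of odd degree, and there are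
decompositions `Fᵢ = Nᵢ·Sᵢ²` with `Nᵢ` squarefree non-constant, `Nᵢ` a gcd of `A` and
`Fᵢ`, `G` associated to `S₀S₁S₂`, and `A` associated to `N₀N₁N₂`. -/
theorem stmt17 (k : Type*) [Field k] [DecidableEq k]
    (A : k[X]) (hA : Squarefree A) (hAdeg : Odd A.natDegree) (hAd : 1 < A.natDegree)
    (α : Fin 3 → k) (hα : Function.Injective α)
    (f : k[X]) (hf : f = ∏ i, (X - C (α i)))
    (F G : k[X]) (heq : A * G ^ 2 = f.comp F)
    (hF : 0 < F.natDegree) (hG : 0 < G.natDegree) :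
    (∀ i j : Fin 3, i ≠ j → IsCoprime (F - C (α i)) (F - C (α j))) ∧
      (∀ i : Fin 3, Odd (F - C (α i)).natDegree) ∧
      ∃ N S : Fin 3 → k[X],
        (∀ i : Fin 3,
          Squarefree (N i) ∧ 0 < (N i).natDegree ∧
            F - C (α i) = N i * (S i) ^ 2 ∧
            Associated (N i) (EuclideanDomain.gcd A (F - C (α i)))) ∧
        Associated G (S 0 * S 1 * S 2) ∧
        Associated A (N 0 * N 1 * N 2) := by
  have hcop : ∀ i j : Fin 3, i ≠ j → IsCoprime (F - C (α i)) (F - C (α j)) := by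
    intro i j hij
    have h0 : α j - α i ≠ 0 := sub_ne_zero.2 fun h => hij (hα h.symm)
    refine ⟨C (α j - α i)⁻¹, -C (α j - α i)⁻¹, ?_⟩
    have : C (α j - α i)⁻¹ * C (α j - α i) = (1 : k[X]) := by
      rw [← C_mul, inv_mul_cancel₀ h0, C_1]
    rw [C_sub] at this
    linear_combination this
  have hdeg : ∀ i, (F - C (α i)).natDegree = F.natDegree := fun i => natDegree_sub_C
  have hne : ∀ i, F - C (α i) ≠ 0 := by
    intro i h
    have := hdeg i
    rw [h, natDegree_zero] at this
    omega
  have hA0 : A ≠ 0 := hA.ne_zero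
  have hG0 : G ≠ 0 := by rintro rfl; simp at hG
  have heq' : A * G ^ 2 = (F - C (α 0)) * (F - C (α 1)) * (F - C (α 2)) := by
    rw [heq, hf, Fin.prod_univ_three]; simp
  have hodd : Odd F.natDegree := by
    have := congrArg natDegree heq'
    rw [natDegree_mul hA0 (pow_ne_zero _ hG0), natDegree_pow,
      natDegree_mul (mul_ne_zero (hne 0) (hne 1)) (hne 2), natDegree_mul (hne 0) (hne 1),
      hdeg, hdeg, hdeg] at this
    rw [Nat.odd_iff] at *
    omega
  have hex : ∀ i, ∃ N S : k[X], F - C (α i) = N * S ^ 2 ∧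
      Associated N (EuclideanDomain.gcd A (F - C (α i))) := by
    intro i
    fin_cases i
    · exact aux17 A G (F - C (α 0)) _ (hne 0) hA0 ((hcop 0 1 (by decide)).mul_right (hcop 0 2 (by decide)))
        (by rw [heq']; ring)
    · exact aux17 A G (F - C (α 1)) _ (hne 1) hA0 ((hcop 1 0 (by decide)).mul_right (hcop 1 2 (by decide)))
        (by rw [heq']; ring)
    · exact aux17 A G (F - C (α 2)) _ (hne 2) hA0 ((hcop 2 0 (by decide)).mul_right (hcop 2 1 (by decide)))
        (by rw [heq']; ring)
  choose N S hNS hN using hex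
  have hNA : ∀ i, N i ∣ A := fun i => (hN i).dvd.trans (EuclideanDomain.gcd_dvd_left _ _)
  have hNF : ∀ i, N i ∣ F - C (α i) := fun i => ⟨_, hNS i⟩
  have hNc : ∀ i j, i ≠ j → IsCoprime (N i) (N j) := fun i j hij =>
    ((hcop i j hij).of_isCoprime_of_dvd_left (hNF i)).of_isCoprime_of_dvd_right (hNF j)
  have hN0 : ∀ i, N i ≠ 0 := fun i h => hA0 (zero_dvd_iff.1 (h ▸ hNA i))
  have hS0 : ∀ i, S i ≠ 0 := fun i h => hne i (by rw [hNS i, h]; simp)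
  obtain ⟨B, hB⟩ : N 0 * N 1 * N 2 ∣ A :=
    ((hNc 0 2 (by decide)).mul_left (hNc 1 2 (by decide))).mul_dvd
      ((hNc 0 1 (by decide)).mul_dvd (hNA 0) (hNA 1)) (hNA 2)
  have hBG : B * G ^ 2 = (S 0 * S 1 * S 2) ^ 2 := by
    apply mul_left_cancel₀ (mul_ne_zero (mul_ne_zero (hN0 0) (hN0 1)) (hN0 2))
    rw [← mul_assoc, ← hB, heq', hNS 0, hNS 1, hNS 2]; ring
  obtain ⟨E, hE⟩ : G ∣ S 0 * S 1 * S 2 :=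
    (IsIntegrallyClosed.pow_dvd_pow_iff two_ne_zero).1 ⟨B, by rw [← hBG, mul_comm]⟩
  have hBE : B = E * E := by
    apply mul_right_cancel₀ (pow_ne_zero 2 hG0)
    rw [hBG, hE]; ring
  have hEu : IsUnit E := hA E ⟨N 0 * N 1 * N 2, by rw [hB, hBE]; ring⟩
  refine ⟨hcop, fun i => by rw [hdeg]; exact hodd, N, S, fun i => ⟨hA.squarefree_of_dvd (hNA i),
    ?_, hNS i, hN i⟩, ?_, ?_⟩
  · have h := congrArg natDegree (hNS i)
    rw [hdeg, natDegree_mul (hN0 i) (pow_ne_zero _ (hS0 i)), natDegree_pow] at h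
    rw [Nat.odd_iff] at hodd
    omega
  · rw [hE]; exact (associated_mul_unit_left G E hEu).symm
  · conv_lhs => rw [hB]
    exact associated_mul_unit_left _ B (by rw [hBE]; exact hEu.mul hEu)
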